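/- Let M be an internally 4-connected binary matroid in which every element is in exactly three triangles and whose ground set has at least 14 elements. If M has a 6-element cocircuit C* = {a, b, c, d, e, f} such that {a, b, c, d} and {a, b, e, f} are circuits of M, then si(M/x) is internally 4-connected for every x in C*. -/

import Mathlib

open Set Matroid

namespace Paper

variable {α : Type*}

/-- A circuit of a matroid: a minimal dependent set. -/
def Circuit (M : Matroid α) (C : Set α) : Prop :=
  C ⊆ M.E ∧ ¬ M.Indep C ∧ ∀ D, D ⊂ C → M.Indep D

/-- A cocircuit: a circuit of the dual matroid. -/
def Cocircuit (M : Matroid α) (C : Set α) : Prop := Circuit M✶ C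

/-- A triangle: a 3-element circuit. -/
def IsTriangle (M : Matroid α) (T : Set α) : Prop := Circuit M T ∧ T.encard = 3

/-- A triad: a 3-element cocircuit. -/
def IsTriad (M : Matroid α) (T : Set α) : Prop := Cocircuit M T ∧ T.encard = 3

/-- The (extended) rank of a set: the supremum of the cardinalities of
independent subsets. -/
noncomputable def eRank (M : Matroid α) (X : Set α) : ℕ∞ :=
  ⨆ I ∈ {I : Set α | M.Indep I ∧ I ⊆ X}, I.encard

/-- The rank of the matroid. -/
noncomputable def eRk (M : Matroid α) : ℕ∞ := eRank M M.E

/-- `(X, Y)` is a `k`-separation of `M`: a partition of the ground set into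
two sets, each of size at least `k`, with `λ(X) = r(X) + r(Y) - r(M) ≤ k - 1`. -/
def IsKSeparation (M : Matroid α) (k : ℕ) (X Y : Set α) : Prop :=
  Disjoint X Y ∧ X ∪ Y = M.E ∧
    eRank M X + eRank M Y ≤ eRk M + ((k - 1 : ℕ) : ℕ∞) ∧
    (k : ℕ∞) ≤ X.encard ∧ (k : ℕ∞) ≤ Y.encard

/-- `M` is `n`-connected if it has no `k`-separation for any positive `k < n`. -/
def NConnected (M : Matroid α) (n : ℕ) : Prop :=
  ∀ k, 1 ≤ k → k < n → ∀ X Y, ¬ IsKSeparation M k X Y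

/-- `M` is internally 4-connected if it is 3-connected and every
3-separation has a side that is a triangle or a triad. -/
def InternallyFourConnected (M : Matroid α) : Prop :=
  NConnected M 3 ∧ ∀ X Y, IsKSeparation M 3 X Y →
    IsTriangle M X ∨ IsTriad M X ∨ IsTriangle M Y ∨ IsTriad M Y

/-- `M` is binary: representable over `GF(2)`. -/
def Binary (M : Matroid α) : Prop :=
  ∃ φ : α → (α →₀ ZMod 2), ∀ I, I ⊆ M.E →
    (M.Indep I ↔ LinearIndependent (ZMod 2) (fun x : I => φ x.1))

/-- Every element of `M` is in exactly three triangles. -/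
def EveryElementInThreeTriangles (M : Matroid α) : Prop :=
  ∀ e ∈ M.E, {T : Set α | IsTriangle M T ∧ e ∈ T}.encard = 3

/-- Deletion of a set of elements. -/
def delete (M : Matroid α) (D : Set α) : Matroid α := M ↾ (M.E \ D)

/-- Contraction of a set of elements. -/
def contract (M : Matroid α) (C : Set α) : Matroid α := (delete M✶ C)✶

/-- A nonloop. -/
def Nonloop (M : Matroid α) (e : α) : Prop := M.Indep {e}

/-- `N` is a simplification of `M`: the restriction of `M` to a set of
nonloops containing exactly one element from each parallel class. -/
def IsSimplificationOf (N M : Matroid α) : Prop :=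
  ∃ S, S ⊆ M.E ∧ N = M ↾ S ∧ (∀ e ∈ S, Nonloop M e) ∧
    ∀ f, Nonloop M f → ∃! e, e ∈ S ∧ M.closure {e} = M.closure {f}

/-- `si(M/e)` is internally 4-connected. -/
def SiContractI4C (M : Matroid α) (e : α) : Prop :=
  ∀ N, IsSimplificationOf N (contract M {e}) → InternallyFourConnected N

/-- A set is fully closed if it is closed in `M` and in `M✶`. -/
def FullyClosed (M : Matroid α) (F : Set α) : Prop :=
  M.closure F = F ∧ M✶.closure F = F

/-- The full closure of a set: the intersection of all fully closed sets
containing it. -/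
def fcl (M : Matroid α) (Z : Set α) : Set α := ⋂₀ {F | Z ⊆ F ∧ FullyClosed M F}

/-- An exact 4-separation: a 4-separation with `λ = 3`. -/
def IsExact4Separation (M : Matroid α) (X Y : Set α) : Prop :=
  Disjoint X Y ∧ X ∪ Y = M.E ∧
    eRank M X + eRank M Y = eRk M + 3 ∧
    (4 : ℕ∞) ≤ X.encard ∧ (4 : ℕ∞) ≤ Y.encard


section Aux

variable {V : Type*} [AddCommGroup V] [Module (ZMod 2) V] {M : Matroid α} {φ : α → V}

def Rep (M : Matroid α) (φ : α → V) : Prop :=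
  ∀ I, I ⊆ M.E → (M.Indep I ↔ LinearIndepOn (ZMod 2) φ I)

lemma two_zero (v : V) : v + v = 0 := ZModModule.add_self v

lemma swap1 {u v w : V} (h : w = u + v) : u = v + w := by
  rw [h, add_comm u v, ← add_assoc, two_zero, zero_add]

lemma swap2 {u v w : V} (h : w = u + v) : v = u + w := by
  rw [h, ← add_assoc, two_zero, zero_add]

lemma zmod2 (x : ZMod 2) : x = 0 ∨ x = 1 := by
  revert x; decide

lemma rep_mem_closure_indep (hR : Rep M φ) {I : Set α} (hI : M.Indep I) {x : α} (hx : x ∈ M.E) :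
    x ∈ M.closure I ↔ φ x ∈ Submodule.span (ZMod 2) (φ '' I) := by
  have h1 := hI.insert_indep_iff (e := x)
  have h2 := hR (insert x I) (insert_subset hx hI.subset_ground)
  rw [linearIndepOn_insert_iff, ← hR I hI.subset_ground, h1] at h2
  by_cases hxI : x ∈ I
  · exact iff_of_true (M.mem_closure_of_mem hxI hI.subset_ground)
      (Submodule.subset_span (mem_image_of_mem _ hxI))
  · simp only [hxI, or_false, hI, true_and, imp_false, mem_sdiff, hx] at h2
    exact not_iff_not.1 h2

lemma rep_mem_closure (hR : Rep M φ) {X : Set α} (hX : X ⊆ M.E) {x : α} (hx : x ∈ M.E) :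
    x ∈ M.closure X ↔ φ x ∈ Submodule.span (ZMod 2) (φ '' X) := by
  obtain ⟨I, hI⟩ := M.exists_isBasis X
  rw [← hI.closure_eq_closure, rep_mem_closure_indep hR hI.indep hx]
  have : Submodule.span (ZMod 2) (φ '' X) = Submodule.span (ZMod 2) (φ '' I) := by
    apply le_antisymm
    · rw [Submodule.span_le]
      rintro _ ⟨y, hy, rfl⟩
      exact (rep_mem_closure_indep hR hI.indep (hX hy)).1 (hI.subset_closure hy)
    · exact Submodule.span_mono (image_mono hI.subset)
  rw [this]

lemma eRank_eq (M : Matroid α) (X : Set α) : eRank M X = M.eRk X := by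
  apply le_antisymm
  · exact iSup₂_le fun I hI => hI.1.encard_le_eRk_of_subset hI.2
  · obtain ⟨I, hI⟩ := M.exists_isBasis' X
    rw [hI.eRk_eq_encard]
    exact le_iSup₂_of_le I ⟨hI.indep, hI.subset⟩ le_rfl

lemma eRk_eq (M : Matroid α) : eRk M = M.eRank := by
  rw [eRk, eRank_eq, Matroid.eRk_ground]

lemma circuit_iff (M : Matroid α) (C : Set α) : Circuit M C ↔ M.IsCircuit C := by
  rw [isCircuit_iff_forall_ssubset]
  constructor
  · rintro ⟨h1, h2, h3⟩
    exact ⟨(not_indep_iff h1).1 h2, fun I hI => h3 I hI⟩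
  · rintro ⟨h1, h2⟩
    exact ⟨h1.subset_ground, h1.not_indep, fun I hI => h2 hI⟩

lemma rank_ne_top (hI4 : InternallyFourConnected M) (hE : (14 : ℕ∞) ≤ M.E.encard) :
    M.eRank ≠ ⊤ := by
  intro htop
  have hne : M.E.Nonempty := by
    rw [← encard_pos]; exact lt_of_lt_of_le (by norm_num) hE
  obtain ⟨x, hx⟩ := hne
  refine hI4.1 1 le_rfl (by norm_num) {x} (M.E \ {x}) ⟨disjoint_sdiff_right, ?_, ?_, ?_, ?_⟩
  · rw [union_sdiff_cancel (singleton_subset_iff.2 hx)]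
  · rw [eRk_eq, htop]; simp
  · simp
  · have := encard_sdiff_singleton_add_one hx
    rw [← this] at hE
    by_contra hcon
    have h0 : (M.E \ {x}).encard = 0 := by
      simpa [not_nonempty_iff_eq_empty] using hcon
    rw [h0] at hE
    norm_num at hE

lemma no_loop (h3 : EveryElementInThreeTriangles M) {x : α} (hx : x ∈ M.E) : M.Indep {x} := by
  have h := h3 x hx
  have hne : {T : Set α | IsTriangle M T ∧ x ∈ T}.Nonempty := by
    rw [← encard_pos, h]; norm_num
  obtain ⟨T, ⟨hT, hc⟩, hxT⟩ := hne
  refine hT.2.2 {x} ⟨singleton_subset_iff.2 hxT, fun hs => ?_⟩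
  have := encard_le_encard hs
  rw [hc, encard_singleton] at this
  norm_num at this

lemma no_par (hI4 : InternallyFourConnected M) (hE : (14 : ℕ∞) ≤ M.E.encard)
    {x y : α} (hx : x ∈ M.E) (hy : y ∈ M.E) (hxy : x ≠ y) : M.Indep {x, y} := by
  by_contra hcon
  have hsub : {x, y} ⊆ M.E := by rintro _ (rfl | rfl) <;> assumption
  refine hI4.1 2 (by norm_num) (by norm_num) {x, y} (M.E \ {x, y})
    ⟨disjoint_sdiff_right, union_sdiff_cancel hsub, ?_, ?_, ?_⟩
  · rw [eRk_eq, eRank_eq, eRank_eq, add_comm]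
    refine add_le_add (M.eRk_le_eRank _) ?_
    have := eRk_lt_encard_of_dep_of_finite (M := M) (X := {x, y}) (by simp)
      ((not_indep_iff hsub).1 hcon)
    rw [encard_pair hxy] at this
    exact Order.le_of_lt_add_one (by simpa [one_add_one_eq_two] using this)
  · rw [encard_pair hxy]; norm_num
  · have := encard_sdiff_add_encard_of_subset hsub
    rw [encard_pair hxy] at this
    rw [← this] at hE
    by_contra hlt
    have hlt : (M.E \ {x, y}).encard < 2 := by simpa using hlt
    have h4 : (14 : ℕ∞) ≤ 2 + 2 := hE.trans (add_le_add_left hlt.le 2)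
    norm_num at h4

lemma rep_ne_zero (hR : Rep M φ) (h3 : EveryElementInThreeTriangles M) {x : α} (hx : x ∈ M.E) :
    φ x ≠ 0 :=
  ((hR {x} (singleton_subset_iff.2 hx)).1 (no_loop h3 hx)).ne_zero rfl

lemma rep_inj (hR : Rep M φ) (hI4 : InternallyFourConnected M) (hE : (14 : ℕ∞) ≤ M.E.encard) :
    InjOn φ M.E := by
  intro x hx y hy h
  by_contra hne
  have hsub : {x, y} ⊆ M.E := by rintro _ (rfl | rfl) <;> assumption
  exact hne (((hR {x, y} hsub).1 (no_par hI4 hE hx hy hne)).injOn (by simp) (by simp) h)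

/-- The existence of a functional for a cocircuit. -/
lemma exists_functional (hR : Rep M φ) {K : Set α} (hK : M.IsCocircuit K) :
    ∃ ψ : V →ₗ[ZMod 2] ZMod 2, (∀ x ∈ K, ψ (φ x) = 1) ∧ ∀ x ∈ M.E \ K, ψ (φ x) = 0 := by
  rw [isCocircuit_iff_minimal_compl_nonspanning'] at hK
  have hKE := hK.prop.2
  have hns := hK.prop.1
  have hcl : ¬ M.E ⊆ M.closure (M.E \ K) := by
    intro h
    exact hns ((spanning_iff_ground_subset_closure sdiff_subset).2 h)
  rw [not_subset] at hcl
  obtain ⟨y, hy, hyc⟩ := hcl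
  rw [rep_mem_closure hR sdiff_subset hy] at hyc
  obtain ⟨ψ, hψ, hker⟩ := Submodule.exists_le_ker_of_notMem hyc
  have h0 : ∀ x ∈ M.E \ K, ψ (φ x) = 0 := fun x hx =>
    hker (Submodule.subset_span (mem_image_of_mem _ hx))
  refine ⟨ψ, fun x hx => ?_, h0⟩
  rcases zmod2 (ψ (φ x)) with h | h
  swap
  · exact h
  exfalso
  have hsp : M.Spanning (M.E \ (K \ {x})) := by
    by_contra hc
    have := hK.le_of_le (y := K \ {x}) ⟨hc, sdiff_subset.trans hKE⟩ sdiff_subset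
    exact (this hx).2 rfl
  have hy2 : y ∈ M.closure (M.E \ (K \ {x})) := by rw [hsp.closure_eq]; exact hy
  rw [rep_mem_closure hR sdiff_subset hy] at hy2
  have hle : Submodule.span (ZMod 2) (φ '' (M.E \ (K \ {x}))) ≤ LinearMap.ker ψ := by
    rw [Submodule.span_le]
    rintro _ ⟨t, ht, rfl⟩
    by_cases htx : t = x
    · subst htx; exact h
    · exact h0 t ⟨ht.1, fun hh => ht.2 ⟨hh, htx⟩⟩
  exact hψ (hle hy2)

/-- Structure collecting the standing facts. -/
structure Good (M : Matroid α) (φ : α → V) : Prop where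
  rep : Rep M φ
  ne : ∀ x ∈ M.E, φ x ≠ 0
  inj : InjOn φ M.E

def tri (M : Matroid α) (φ : α → V) (u v : α) : Set α :=
  {x | x ∈ M.E ∧ (x = u ∨ x = v ∨ φ x = φ u + φ v)}

lemma Good.pair (hG : Good M φ) {x y : α} (hx : x ∈ M.E) (hy : y ∈ M.E) (hxy : x ≠ y) :
    M.Indep {x, y} := by
  have hsub : {x, y} ⊆ M.E := by rintro _ (rfl | rfl) <;> assumption
  rw [hG.rep _ hsub, linearIndepOn_insert (by simpa using hxy)]
  refine ⟨?_, ?_⟩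
  · rw [linearIndepOn_singleton_iff]
    exact hG.ne y hy
  · rw [image_singleton, Submodule.mem_span_singleton]
    rintro ⟨c, hc⟩
    rcases zmod2 c with rfl | rfl
    · rw [zero_smul] at hc; exact hG.ne x hx hc.symm
    · rw [one_smul] at hc; exact hxy (hG.inj hx hy hc.symm)

lemma Good.tri_eq (hG : Good M φ) {u v w : α} (hu : u ∈ M.E) (hv : v ∈ M.E) (hw : w ∈ M.E)
    (h : φ w = φ u + φ v) : tri M φ u v = {u, v, w} := by
  ext x
  constructor
  · rintro ⟨hx, rfl | rfl | h'⟩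
    · simp
    · simp
    · rw [← h] at h'
      simp [hG.inj hx hw h']
  · rintro (rfl | rfl | rfl)
    · exact ⟨hu, by simp⟩
    · exact ⟨hv, by simp⟩
    · exact ⟨hw, by simp [h]⟩

lemma Good.tri_isTriangle (hG : Good M φ) {u v w : α} (hu : u ∈ M.E) (hv : v ∈ M.E)
    (hw : w ∈ M.E) (huv : u ≠ v) (h : φ w = φ u + φ v) : IsTriangle M (tri M φ u v) := by
  have hwu : u ≠ w := by
    rintro rfl
    exact hG.ne v hv (by simpa using h)
  have hwv : v ≠ w := by
    rintro rfl
    exact hG.ne u hu (by simpa using h)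
  rw [hG.tri_eq hu hv hw h]
  have hsub : ({u, v, w} : Set α) ⊆ M.E := by rintro _ (rfl | rfl | rfl) <;> assumption
  refine ⟨(circuit_iff _ _).2 ?_, ?_⟩
  · rw [isCircuit_iff_dep_forall_sdiff_singleton_indep, ← not_indep_iff hsub]
    constructor
    · rw [hG.rep _ hsub, linearIndepOn_insert (by simp [huv, hwu])]
      rintro ⟨-, h2⟩
      apply h2
      have : φ u = φ v + φ w := swap1 h
      rw [this]
      exact add_mem (Submodule.subset_span ⟨v, by simp, rfl⟩)
        (Submodule.subset_span ⟨w, by simp, rfl⟩)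
    · rintro x (rfl | rfl | rfl)
      · exact (hG.pair hv hw hwv).subset (by rintro y ⟨rfl | rfl | rfl, h2⟩ <;> simp_all)
      · exact (hG.pair hu hw hwu).subset (by rintro y ⟨rfl | rfl | rfl, h2⟩ <;> simp_all)
      · exact (hG.pair hu hv huv).subset (by rintro y ⟨rfl | rfl | rfl, h2⟩ <;> simp_all)
  · rw [encard_eq_three]
    exact ⟨u, v, w, huv, hwu, hwv, rfl⟩

lemma Good.of_triple (hG : Good M φ) {u v w : α} (hT : IsTriangle M {u, v, w}) (huv : u ≠ v)
    (huw : u ≠ w) (hvw : v ≠ w) : φ w = φ u + φ v := by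
  have hsub := hT.1.1
  have hu : u ∈ M.E := hsub (by simp)
  have hv : v ∈ M.E := hsub (by simp)
  have hw : w ∈ M.E := hsub (by simp)
  have hnot := hT.1.2.1
  have : w ∈ M.closure {u, v} := by
    by_contra hc
    apply hnot
    have : ({u, v, w} : Set α) = insert w {u, v} := by ext; simp; tauto
    rw [this, (hG.pair hu hv huv).insert_indep_iff]
    exact Or.inl ⟨hw, hc⟩
  rw [rep_mem_closure hG.rep (by rintro _ (rfl | rfl) <;> assumption) hw, image_pair,
    Submodule.mem_span_pair] at this
  obtain ⟨p, q, h⟩ := this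
  rcases zmod2 p with rfl | rfl <;> rcases zmod2 q with rfl | rfl <;>
    simp only [zero_smul, one_smul, zero_add, add_zero] at h
  · exact absurd h.symm (hG.ne w hw)
  · exact absurd (hG.inj hv hw h) hvw
  · exact absurd (hG.inj hu hw h) huw
  · exact h.symm

lemma Good.triangle_spec (hG : Good M φ) {T : Set α} (hT : IsTriangle M T) {u v : α}
    (hu : u ∈ T) (hv : v ∈ T) (huv : u ≠ v) :
    ∃ w ∈ T, w ≠ u ∧ w ≠ v ∧ φ w = φ u + φ v ∧ T = tri M φ u v := by
  obtain ⟨x, y, z, hxy, hxz, hyz, rfl⟩ := encard_eq_three.1 hT.2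
  have key : ∃ w, w ≠ u ∧ w ≠ v ∧ ({x, y, z} : Set α) = {u, v, w} := by
    simp only [mem_insert_iff, mem_singleton_iff] at hu hv
    have aux : ∀ w, w ≠ u → w ≠ v → w ∈ ({x, y, z} : Set α) → ({x, y, z} : Set α) = {u, v, w} := by
      intro w h1 h2 h3
      simp only [mem_insert_iff, mem_singleton_iff] at h3
      ext t; simp only [mem_insert_iff, mem_singleton_iff]
      grind
    by_cases h1 : x ≠ u ∧ x ≠ v
    · exact ⟨x, h1.1, h1.2, aux x h1.1 h1.2 (by simp)⟩
    by_cases h2 : y ≠ u ∧ y ≠ v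
    · exact ⟨y, h2.1, h2.2, aux y h2.1 h2.2 (by simp)⟩
    by_cases h3 : z ≠ u ∧ z ≠ v
    · exact ⟨z, h3.1, h3.2, aux z h3.1 h3.2 (by simp)⟩
    grind
  obtain ⟨w, hwu, hwv, heq⟩ := key
  rw [heq] at hT ⊢
  have hφ := hG.of_triple hT huv hwu.symm hwv.symm
  exact ⟨w, by simp, hwu, hwv, hφ,
    (hG.tri_eq (hT.1.1 (by simp)) (hT.1.1 (by simp)) (hT.1.1 (by simp)) hφ).symm⟩

lemma Good.triangle_other {T : Set α} (hT : IsTriangle M T) {u : α} :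
    ∃ v ∈ T, v ≠ u := by
  obtain ⟨x, y, z, hxy, hxz, hyz, rfl⟩ := encard_eq_three.1 hT.2
  by_cases h : x = u
  · exact ⟨y, by simp, fun h' => hxy (h.trans h'.symm)⟩
  · exact ⟨x, by simp, h⟩

/-- complement of a flat. -/
lemma Good.four_le (hG : Good M φ) (h3 : EveryElementInThreeTriangles M) {X : Set α}
    (hne : (M.E \ M.closure X).Nonempty) : 4 ≤ (M.E \ M.closure X).encard := by
  obtain ⟨y, hy⟩ := hne
  have hex : ∀ T ∈ {T : Set α | IsTriangle M T ∧ y ∈ T},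
      ∃ s ∈ (M.E \ M.closure X) \ {y}, s ∈ T := by
    rintro T ⟨hT, hyT⟩
    obtain ⟨s, hs, hsy⟩ := Good.triangle_other hT (u := y)
    obtain ⟨t, ht, hty, hts, hφ, -⟩ := hG.triangle_spec hT hyT hs hsy.symm
    have hsE := hT.1.1 hs
    have htE := hT.1.1 ht
    by_contra! hcon
    have h1 : s ∈ M.closure X := by
      by_contra hc; exact hcon s ⟨⟨hsE, hc⟩, hsy⟩ hs
    have h2 : t ∈ M.closure X := by
      by_contra hc; exact hcon t ⟨⟨htE, hc⟩, hty⟩ ht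
    apply hy.2
    rw [← M.closure_closure, rep_mem_closure hG.rep (M.closure_subset_ground _) hy.1]
    have : φ y = φ s + φ t := swap1 hφ
    rw [this]
    exact add_mem (Submodule.subset_span ⟨s, h1, rfl⟩) (Submodule.subset_span ⟨t, h2, rfl⟩)
  haveI : Nonempty α := ⟨y⟩
  choose! g hg hgT using hex
  have h1 : {T : Set α | IsTriangle M T ∧ y ∈ T}.encard ≤ ((M.E \ M.closure X) \ {y}).encard := by
    refine encard_le_encard_of_injOn (f := g) hg ?_
    intro T hT T' hT' h
    obtain ⟨-, -, -, -, -, e1⟩ := hG.triangle_spec hT.1 hT.2 (hgT T hT) (Ne.symm (hg T hT).2)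
    obtain ⟨-, -, -, -, -, e2⟩ := hG.triangle_spec hT'.1 hT'.2 (hgT T' hT') (Ne.symm (hg T' hT').2)
    rw [e1, e2, h]
  rw [h3 y hy.1] at h1
  rw [← encard_sdiff_singleton_add_one hy]
  calc (4 : ℕ∞) = 3 + 1 := by norm_num
    _ ≤ _ := by gcongr

def nbr (M : Matroid α) (φ : α → V) (K : Set α) (u : α) : Set α :=
  {v | v ∈ K ∧ v ≠ u ∧ ∃ w ∈ M.E, φ w = φ u + φ v}

lemma Good.nbr_encard (hG : Good M φ) (h3 : EveryElementInThreeTriangles M) {K : Set α}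
    (hKE : K ⊆ M.E) {ψ : V →ₗ[ZMod 2] ZMod 2} (h1 : ∀ x ∈ K, ψ (φ x) = 1)
    (h0 : ∀ x ∈ M.E \ K, ψ (φ x) = 0) {u : α} (hu : u ∈ K) : (nbr M φ K u).encard = 3 := by
  rw [← h3 u (hKE hu)]
  have himg : {T : Set α | IsTriangle M T ∧ u ∈ T} = (tri M φ u) '' (nbr M φ K u) := by
    ext T
    constructor
    · rintro ⟨hT, huT⟩
      obtain ⟨s, hs, hsu⟩ := Good.triangle_other hT (u := u)
      obtain ⟨t, ht, htu, hts, hφ, e1⟩ := hG.triangle_spec hT huT hs hsu.symm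
      obtain ⟨-, -, -, -, hφ2, e2⟩ := hG.triangle_spec hT huT ht htu.symm
      have hsE := hT.1.1 hs
      have htE := hT.1.1 ht
      by_cases hsK : s ∈ K
      · exact ⟨s, ⟨hsK, hsu, t, htE, hφ⟩, e1.symm⟩
      by_cases htK : t ∈ K
      · refine ⟨t, ⟨htK, htu, s, hsE, ?_⟩, e2.symm⟩
        exact swap2 hφ
      exfalso
      have := congrArg ψ hφ
      rw [map_add, h0 t ⟨htE, htK⟩, h0 s ⟨hsE, hsK⟩, h1 u hu] at this
      exact absurd this (by decide)
    · rintro ⟨v, ⟨hv, hvu, w, hw, hφ⟩, rfl⟩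
      exact ⟨hG.tri_isTriangle (hKE hu) (hKE hv) hw hvu.symm hφ, hKE hu, Or.inl rfl⟩
  rw [himg, InjOn.encard_image]
  rintro v ⟨hv, hvu, -⟩ v' ⟨hv', hvu', -⟩ h
  have : v ∈ tri M φ u v' := by
    rw [← h]; exact ⟨hKE hv, Or.inr (Or.inl rfl)⟩
  rcases this.2 with h' | h' | h'
  · exact absurd h' hvu
  · exact h'
  · have := congrArg ψ h'
    rw [map_add, h1 v hv, h1 u hu, h1 v' hv'] at this
    exact absurd this (by decide)

end Aux

lemma insert_step {x : α} {s : Set α} {n : ℕ} (h : (insert x s).encard = (n : ℕ∞) + 1)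
    (hs : s.encard ≤ n) : x ∉ s ∧ s.encard = n := by
  have hx : x ∉ s := by
    intro hx
    rw [insert_eq_of_mem hx] at h
    rw [h] at hs
    have : n + 1 ≤ n := by exact_mod_cast hs
    omega
  refine ⟨hx, ?_⟩
  rw [encard_insert_of_notMem hx] at h
  exact ENat.add_left_injective_of_ne_top ENat.one_ne_top h

lemma insert_bd {x : α} {s : Set α} {n : ℕ} (hs : s.encard ≤ n) :
    (insert x s).encard ≤ ((n + 1 : ℕ) : ℕ∞) := by
  refine (encard_insert_le _ _).trans ?_
  push_cast
  gcongr

lemma distinct_of {a b c d e f : α} (h : ({a, b, c, d, e, f} : Set α).encard = 6) :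
    a ∉ ({b, c, d, e, f} : Set α) ∧ b ∉ ({c, d, e, f} : Set α) ∧ c ∉ ({d, e, f} : Set α) ∧
      d ∉ ({e, f} : Set α) ∧ e ∉ ({f} : Set α) := by
  have b1 : ({f} : Set α).encard ≤ (1 : ℕ) := by simp
  have b2 := insert_bd (x := e) b1
  have b3 := insert_bd (x := d) b2
  have b4 := insert_bd (x := c) b3
  have b5 := insert_bd (x := b) b4
  obtain ⟨h1, e1⟩ := insert_step (n := 5) (by rw [h]; norm_num) b5
  obtain ⟨h2, e2⟩ := insert_step (n := 4) (by rw [e1]; norm_num) b4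
  obtain ⟨h3, e3⟩ := insert_step (n := 3) (by rw [e2]; norm_num) b3
  obtain ⟨h4, e4⟩ := insert_step (n := 2) (by rw [e3]; norm_num) b2
  obtain ⟨h5, e5⟩ := insert_step (n := 1) (by rw [e4]; norm_num) b1
  exact ⟨h1, h2, h3, h4, h5⟩

section Aux2

variable {V : Type*} [AddCommGroup V] [Module (ZMod 2) V] {M : Matroid α} {φ : α → V}

lemma rel1 {a b c d : V} (h : a + b = c + d) : a + c = b + d := by
  have : a = c + d + b := by rw [← h, add_assoc, two_zero, add_zero]
  rw [this, add_right_comm, add_right_comm c d c, two_zero, zero_add, add_comm]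

lemma rel2 {a b c d : V} (h : a + b = c + d) : a + d = b + c :=
  rel1 (h.trans (add_comm _ _))

lemma Good.exists_w (hG : Good M φ) (h3 : EveryElementInThreeTriangles M) {K : Set α}
    (hKE : K ⊆ M.E) {ψ : V →ₗ[ZMod 2] ZMod 2} (h1 : ∀ x ∈ K, ψ (φ x) = 1)
    (h0 : ∀ x ∈ M.E \ K, ψ (φ x) = 0) {a b c d e f : α} (hK : K = {a, b, c, d, e, f})
    (hK6 : K.encard = 6) (r1 : φ a + φ b = φ c + φ d) (r2 : φ a + φ b = φ e + φ f) :
    ∃ w ∈ M.E, φ w = φ c + φ e ∨ φ w = φ c + φ f := by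
  by_contra! hcon
  have hd := distinct_of (hK ▸ hK6)
  simp only [mem_insert_iff, mem_singleton_iff, not_or] at hd
  obtain ⟨⟨hab, hac, had, hae, haf⟩, ⟨hbc, hbd, hbe, hbf⟩, ⟨hcd, hce, hcf⟩, ⟨hde, hdf⟩, hef⟩ := hd
  have hn := fun {u : α} (hu : u ∈ K) => hG.nbr_encard h3 hKE h1 h0 hu
  have r3 : φ c + φ d = φ e + φ f := r1.symm.trans r2
  have hc : nbr M φ K c = {a, b, d} := by
    have hsub : nbr M φ K c ⊆ {a, b, d} := by
      rintro v ⟨hv, hvc, w, hw, hφ⟩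
      rw [hK] at hv
      rcases hv with rfl | rfl | rfl | rfl | rfl | rfl
      · simp
      · simp
      · exact absurd rfl hvc
      · simp
      · exact absurd hφ (hcon w hw).1
      · exact absurd hφ (hcon w hw).2
    refine Finite.eq_of_subset_of_encard_le' (by simp) hsub ?_
    rw [hn (by rw [hK]; simp), encard_eq_three.2 ⟨a, b, d, hab, had, hbd, rfl⟩]
  have he : nbr M φ K e = {a, b, f} := by
    have hsub : nbr M φ K e ⊆ {a, b, f} := by
      rintro v ⟨hv, hvc, w, hw, hφ⟩
      rw [hK] at hv
      rcases hv with rfl | rfl | rfl | rfl | rfl | rfl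
      · simp
      · simp
      · exact absurd (hφ.trans (add_comm _ _)) (hcon w hw).1
      · refine absurd (hφ.trans ?_) (hcon w hw).2
        rw [rel2 r3, add_comm]
      · exact absurd rfl hvc
      · simp
    refine Finite.eq_of_subset_of_encard_le' (by simp) hsub ?_
    rw [hn (by rw [hK]; simp), encard_eq_three.2 ⟨a, b, f, hab, haf, hbf, rfl⟩]
  obtain ⟨-, -, w1, hw1, p1⟩ : a ∈ nbr M φ K c := by rw [hc]; simp
  obtain ⟨-, -, w2, hw2, p2⟩ : b ∈ nbr M φ K c := by rw [hc]; simp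
  obtain ⟨-, -, w3, hw3, p3⟩ : d ∈ nbr M φ K c := by rw [hc]; simp
  obtain ⟨-, -, w4, hw4, p4⟩ : a ∈ nbr M φ K e := by rw [he]; simp
  have hsub : {b, c, d, e} ⊆ nbr M φ K a := by
    rintro v (rfl | rfl | rfl | rfl)
    · exact ⟨by rw [hK]; simp, Ne.symm hab, w3, hw3, by rw [p3, r1]⟩
    · exact ⟨by rw [hK]; simp, Ne.symm hac, w1, hw1, by rw [p1, add_comm]⟩
    · exact ⟨by rw [hK]; simp, Ne.symm had, w2, hw2, by rw [p2, rel2 r1, add_comm]⟩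
    · exact ⟨by rw [hK]; simp, Ne.symm hae, w4, hw4, by rw [p4, add_comm]⟩
  have := encard_le_encard hsub
  rw [hn (by rw [hK]; simp), encard_insert_of_notMem (by simp [hbc, hbd, hbe]),
    encard_eq_three.2 ⟨c, d, e, hcd, hce, hde, rfl⟩] at this
  norm_num at this

/-- flats containing `a`. -/
lemma Good.flat_add (hG : Good M φ) {X : Set α} {x y z : α} (hx : x ∈ M.closure X)
    (hy : y ∈ M.closure X) (hz : z ∈ M.E) (h : φ z = φ x + φ y) : z ∈ M.closure X := by
  rw [← M.closure_closure, rep_mem_closure hG.rep (M.closure_subset_ground _) hz, h]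
  exact add_mem (Submodule.subset_span ⟨x, hx, rfl⟩) (Submodule.subset_span ⟨y, hy, rfl⟩)

lemma Good.flat_add3 (hG : Good M φ) {X : Set α} {a x y z : α} (ha : a ∈ M.closure X)
    (hz : z ∈ M.E) (h : φ a + φ x = φ y + φ z)
    (hx : x ∈ M.closure X) (hy : y ∈ M.closure X) : z ∈ M.closure X := by
  rw [← M.closure_closure, rep_mem_closure hG.rep (M.closure_subset_ground _) hz]
  have : φ z = φ y + (φ a + φ x) := swap2 h
  rw [this]
  exact add_mem (Submodule.subset_span ⟨y, hy, rfl⟩)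
    (add_mem (Submodule.subset_span ⟨a, ha, rfl⟩) (Submodule.subset_span ⟨x, hx, rfl⟩))

lemma Good.span_side (hG : Good M φ) {a b c d e f w : α} {X Y : Set α}
    (hb : b ∈ M.E) (hc : c ∈ M.E) (hd : d ∈ M.E) (he : e ∈ M.E) (hf : f ∈ M.E) (hw : w ∈ M.E)
    (r1 : φ a + φ b = φ c + φ d) (r2 : φ a + φ b = φ e + φ f) (rw : φ w = φ c + φ e)
    (haX : a ∈ M.closure X) (haY : a ∈ M.closure Y)
    (hXY : ∀ x ∈ M.E, x ∈ M.closure X ∨ x ∈ M.closure Y) :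
    {a, b, c, d, e, f} ⊆ M.closure X ∨ {a, b, c, d, e, f} ⊆ M.closure Y := by
  have r3 : φ c + φ d = φ e + φ f := r1.symm.trans r2
  have rw2 : φ w = φ d + φ f := rw.trans (rel1 r3)
  have lines : ∀ Z : Set α, a ∈ M.closure Z →
      (b ∈ M.closure Z → c ∈ M.closure Z → d ∈ M.closure Z) ∧
      (b ∈ M.closure Z → d ∈ M.closure Z → c ∈ M.closure Z) ∧
      (c ∈ M.closure Z → d ∈ M.closure Z → b ∈ M.closure Z) ∧
      (b ∈ M.closure Z → e ∈ M.closure Z → f ∈ M.closure Z) ∧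
      (b ∈ M.closure Z → f ∈ M.closure Z → e ∈ M.closure Z) ∧
      (e ∈ M.closure Z → f ∈ M.closure Z → b ∈ M.closure Z) ∧
      (c ∈ M.closure Z → w ∈ M.closure Z → e ∈ M.closure Z) ∧
      (e ∈ M.closure Z → w ∈ M.closure Z → c ∈ M.closure Z) ∧
      (d ∈ M.closure Z → w ∈ M.closure Z → f ∈ M.closure Z) ∧
      (f ∈ M.closure Z → w ∈ M.closure Z → d ∈ M.closure Z) := by
    intro Z ha
    have q1 : φ a + φ c = φ b + φ d := rel1 r1
    have q1' : φ a + φ d = φ b + φ c := rel2 r1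
    have q2 : φ a + φ e = φ b + φ f := rel1 r2
    refine ⟨fun h h' => ?_, fun h h' => ?_, fun h h' => ?_, fun h h' => ?_, fun h h' => ?_,
      fun h h' => ?_, fun h h' => ?_, fun h h' => ?_, fun h h' => ?_, fun h h' => ?_⟩
    · exact hG.flat_add3 ha hd r1 h h'
    · exact hG.flat_add3 ha hc (r1.trans (add_comm _ _)) h h'
    · exact hG.flat_add3 ha hb (q1.trans (add_comm _ _)) h h'
    · exact hG.flat_add3 ha hf r2 h h'
    · exact hG.flat_add3 ha he (r2.trans (add_comm _ _)) h h'
    · exact hG.flat_add3 ha hb (q2.trans (add_comm _ _)) h h'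
    · exact hG.flat_add h h' he (swap2 rw)
    · exact hG.flat_add h h' hc (swap1 rw)
    · exact hG.flat_add h h' hf (swap2 rw2)
    · exact hG.flat_add h h' hd (swap1 rw2)
  have lX := lines X haX
  have lY := lines Y haY
  have xb := hXY b hb
  have xc := hXY c hc
  have xd := hXY d hd
  have xe := hXY e he
  have xf := hXY f hf
  have xw := hXY w hw
  simp only [insert_subset_iff, singleton_subset_iff]
  clear lines hXY hb hc hd he hf hw r1 r2 rw r3 rw2
  generalize (a ∈ M.closure X) = a1 at *
  generalize (b ∈ M.closure X) = b1 at *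
  generalize (c ∈ M.closure X) = c1 at *
  generalize (d ∈ M.closure X) = d1 at *
  generalize (e ∈ M.closure X) = e1 at *
  generalize (f ∈ M.closure X) = f1 at *
  generalize (w ∈ M.closure X) = w1 at *
  generalize (a ∈ M.closure Y) = a2 at *
  generalize (b ∈ M.closure Y) = b2 at *
  generalize (c ∈ M.closure Y) = c2 at *
  generalize (d ∈ M.closure Y) = d2 at *
  generalize (e ∈ M.closure Y) = e2 at *
  generalize (f ∈ M.closure Y) = f2 at *
  generalize (w ∈ M.closure Y) = w2 at *
  grind

lemma contract_eRk {a : α} (ha : M.Indep {a}) {X : Set α} (hX : X ⊆ M.E \ {a}) :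
    (M ／ {a}).eRk X + 1 = M.eRk (insert a X) := by
  obtain ⟨J, hJ⟩ := (M ／ {a}).exists_isBasis X
  have h := ha.union_isBasis_union_of_contract_isBasis hJ
  rw [union_singleton, union_singleton] at h
  rw [hJ.eRk_eq_encard, h.eRk_eq_encard, encard_insert_of_notMem]
  exact fun haJ => (hX (hJ.subset haJ)).2 rfl

/-- Small-rank sets in a simplification. -/
lemma Good.small (hG : Good M φ) {a : α} {S Y : Set α} (ha : a ∈ M.E)
    (hS : S ⊆ M.E \ {a}) (hYS : Y ⊆ S)
    (hp : ∀ x ∈ S, ∀ y ∈ S, x ≠ y → (M ／ {a}).Indep {x, y})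
    (hs : ∀ x ∈ S, (M ／ {a}).Indep {x}) {k : ℕ} (hk1 : 1 ≤ k) (hk3 : k < 4)
    (hkY : (k : ℕ∞) ≤ Y.encard) (hrk : (M ／ {a}).eRk Y ≤ ((k - 1 : ℕ) : ℕ∞)) :
    k = 3 ∧ IsTriangle ((M ／ {a}) ↾ S) Y := by
  have hai : M.IsNonloop a := by
    have := hG.ne a ha
    rw [← indep_singleton, hG.rep _ (singleton_subset_iff.2 ha), linearIndepOn_singleton_iff]
    exact this
  obtain rfl | rfl | rfl : k = 1 ∨ k = 2 ∨ k = 3 := by omega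
  · exfalso
    have : Y.Nonempty := by
      rw [← encard_pos]; exact lt_of_lt_of_le (by norm_num) hkY
    obtain ⟨y, hy⟩ := this
    have h1 := (hs y (hYS hy)).encard_le_eRk_of_subset (singleton_subset_iff.2 hy)
    rw [encard_singleton] at h1
    have := h1.trans hrk
    norm_num at this
  · exfalso
    have : 1 < Y.encard := lt_of_lt_of_le (by norm_num) hkY
    obtain ⟨x, y, hx, hy, hxy⟩ := one_lt_encard_iff.1 this
    have h1 := (hp x (hYS hx) y (hYS hy) hxy).encard_le_eRk_of_subset (pair_subset hx hy)
    rw [encard_pair hxy] at h1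
    have := h1.trans hrk
    norm_num at this
  · refine ⟨rfl, ?_⟩
    have hpne : ∀ x ∈ S, ∀ y ∈ S, x ≠ y → φ x + φ y ≠ 0 ∧ φ x + φ y ≠ φ a := by
      intro x hx y hy hxy
      have hi := (hai.contractElem_indep_iff.1 (hp x hx y hy hxy)).2
      rw [hG.rep _ hi.subset_ground, linearIndepOn_insert] at hi
      · constructor
        · intro h0
          refine hxy (hG.inj (hS hx).1 (hS hy).1 ?_)
          have : φ x = φ y + 0 := swap1 h0.symm
          rwa [add_zero] at this
        · intro h0
          apply hi.2
          rw [← h0]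
          exact add_mem (Submodule.subset_span ⟨x, by simp, rfl⟩)
            (Submodule.subset_span ⟨y, by simp, rfl⟩)
      · rintro (rfl | h)
        · exact (hS hx).2 rfl
        · exact (hS hy).2 (Eq.symm h)
    have key : ∀ x ∈ Y, ∀ y ∈ Y, ∀ z ∈ Y, x ≠ y → x ≠ z → y ≠ z →
        ¬ (M ／ {a}).Indep {x, y, z} := by
      intro x hx y hy z hz hxy hxz hyz hi
      have h1 := hi.encard_le_eRk_of_subset
        (show {x, y, z} ⊆ Y by rintro _ (rfl | rfl | rfl) <;> assumption)
      rw [encard_eq_three.2 ⟨x, y, z, hxy, hxz, hyz, rfl⟩] at h1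
      have := h1.trans hrk
      norm_num at this
    have key2 : ∀ x ∈ Y, ∀ y ∈ Y, ∀ z ∈ Y, x ≠ y → x ≠ z → y ≠ z →
        φ z = φ x + φ y ∨ φ z = φ a + (φ x + φ y) := by
      intro x hx y hy z hz hxy hxz hyz
      have hni := key x hx y hy z hz hxy hxz hyz
      have hxyi := (hai.contractElem_indep_iff.1 (hp x (hYS hx) y (hYS hy) hxy)).2
      have hza : z ≠ a := fun h => (hS (hYS hz)).2 h
      rw [hai.contractElem_indep_iff] at hni
      have haxyz : a ∉ ({x, y, z} : Set α) := by
        rintro (h | h | h)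
        · exact (hS (hYS hx)).2 h.symm
        · exact (hS (hYS hy)).2 h.symm
        · exact (hS (hYS hz)).2 (Eq.symm h)
      have hni : ¬ M.Indep (insert z {a, x, y}) := by
        intro h
        apply hni
        refine ⟨haxyz, ?_⟩
        have : insert a ({x, y, z} : Set α) = insert z {a, x, y} := by ext; simp; tauto
        rwa [this]
      have hzc : z ∈ M.closure {a, x, y} := by
        by_contra hc
        apply hni
        rw [hxyi.insert_indep_iff]
        exact Or.inl ⟨(hS (hYS hz)).1, hc⟩
      rw [rep_mem_closure_indep hG.rep hxyi (hS (hYS hz)).1, image_insert_eq, image_pair,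
        Submodule.mem_span_insert] at hzc
      obtain ⟨p, v, hv, hzv⟩ := hzc
      rw [Submodule.mem_span_pair] at hv
      obtain ⟨q, r, rfl⟩ := hv
      have nz := (hai.contractElem_indep_iff.1 (hs z (hYS hz))).2
      have nz1 : φ z ≠ 0 := hG.ne z (hS (hYS hz)).1
      have nz2 : φ z ≠ φ a := fun h => hza (hG.inj (hS (hYS hz)).1 ha h)
      have n1 := hpne x (hYS hx) z (hYS hz) hxz
      have n2 := hpne y (hYS hy) z (hYS hz) hyz
      rcases zmod2 p with rfl | rfl <;> rcases zmod2 q with rfl | rfl <;>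
        rcases zmod2 r with rfl | rfl <;>
        simp only [zero_smul, one_smul, zero_add, add_zero] at hzv
      · exact absurd hzv nz1
      · exact absurd (by rw [hzv, two_zero]) n2.1
      · exact absurd (by rw [hzv, two_zero]) n1.1
      · exact Or.inl hzv
      · exact absurd hzv nz2
      · exact absurd (swap1 (hzv.trans rfl)).symm n2.2
      · exact absurd (swap1 (hzv.trans rfl)).symm n1.2
      · exact Or.inr hzv
    obtain ⟨T, hTY, hT3⟩ := exists_subset_encard_eq hkY
    obtain ⟨x, y, z, hxy, hxz, hyz, rfl⟩ := encard_eq_three.1 hT3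
    have hx : x ∈ Y := hTY (by simp)
    have hy : y ∈ Y := hTY (by simp)
    have hz : z ∈ Y := hTY (by simp)
    have hYeq : Y = {x, y, z} := by
      refine subset_antisymm (fun t ht => ?_) hTY
      by_contra htn
      simp only [mem_insert_iff, mem_singleton_iff, not_or] at htn
      have n := hpne z (hYS hz) t (hYS ht) (Ne.symm htn.2.2)
      have e1 := key2 x hx y hy z hz hxy hxz hyz
      have e2 := key2 x hx y hy t ht hxy (Ne.symm htn.1) (Ne.symm htn.2.1)
      rcases e1 with e1 | e1 <;> rcases e2 with e2 | e2 <;> rw [e1, e2] at n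
      · exact n.1 (two_zero _)
      · apply n.2
        rw [add_left_comm, two_zero, add_zero]
      · apply n.2
        rw [add_assoc, two_zero, add_zero]
      · exact n.1 (two_zero _)
    rw [hYeq] at hYS ⊢
    refine ⟨⟨hYS, ?_, ?_⟩, hT3⟩
    · rw [restrict_indep_iff]
      exact fun h => key x hx y hy z hz hxy hxz hyz h.1
    · intro D hD
      rw [restrict_indep_iff]
      refine ⟨?_, hD.subset.trans hYS⟩
      obtain ⟨t, ht, htD⟩ := exists_of_ssubset hD
      rcases ht with rfl | rfl | rfl
      · refine (hp y (hYS (by simp)) z (hYS (by simp)) hyz).subset fun s hs => ?_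
        rcases hD.subset hs with rfl | h | h
        · exact absurd hs htD
        · simp [h]
        · simp [show s = _ from h]
      · refine (hp x (hYS (by simp)) z (hYS (by simp)) hxz).subset fun s hs => ?_
        rcases hD.subset hs with h | rfl | h
        · simp [h]
        · exact absurd hs htD
        · simp [show s = _ from h]
      · refine (hp x (hYS (by simp)) y (hYS (by simp)) hxy).subset fun s hs => ?_
        rcases hD.subset hs with h | h | h
        · simp [h]
        · simp [h]
        · exact absurd hs (by rw [show s = _ from h]; exact htD)

lemma Good.half (hG : Good M φ) (hI4 : InternallyFourConnected M)
    (h3 : EveryElementInThreeTriangles M) (hr : M.eRank ≠ ⊤) {K : Set α}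
    {ψ : V →ₗ[ZMod 2] ZMod 2} (h1 : ∀ x ∈ K, ψ (φ x) = 1)
    (h0 : ∀ x ∈ M.E \ K, ψ (φ x) = 0) (hK6 : K.encard = 6) {a : α} (haK : a ∈ K)
    {S X Y : Set α} (ha : a ∈ M.E)
    (hS : S ⊆ M.E \ {a})
    (hp : ∀ x ∈ S, ∀ y ∈ S, x ≠ y → (M ／ {a}).Indep {x, y})
    (hs : ∀ x ∈ S, (M ／ {a}).Indep {x}) {k : ℕ} (hk1 : 1 ≤ k) (hk3 : k < 4)
    (hsp : M.eRk (insert a S) = M.eRank)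
    (hsep : IsKSeparation ((M ／ {a}) ↾ S) k X Y)
    (hXY : ∀ x ∈ M.E, x ∈ M.closure (insert a X) ∨ x ∈ M.closure (insert a Y))
    (hKX : K ⊆ M.closure (insert a X)) : k = 3 ∧ IsTriangle ((M ／ {a}) ↾ S) Y := by
  obtain ⟨hdj, hun, hrk, hkX, hkY⟩ := hsep
  rw [restrict_ground_eq] at hun
  have hXS : X ⊆ S := hun ▸ subset_union_left
  have hYS : Y ⊆ S := hun ▸ subset_union_right
  have hai : M.Indep {a} := by
    rw [hG.rep _ (singleton_subset_iff.2 ha), linearIndepOn_singleton_iff]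
    exact hG.ne a ha
  rw [eRk, restrict_ground_eq, eRank_eq, eRank_eq, eRank_eq, restrict_eRk_eq _ hXS,
    restrict_eRk_eq _ hYS, restrict_eRk_eq _ subset_rfl] at hrk
  have cX := contract_eRk hai (hXS.trans hS)
  have cY := contract_eRk hai (hYS.trans hS)
  have cS := contract_eRk hai hS
  rw [hsp] at cS
  have hYE : insert a Y ⊆ M.E := insert_subset ha ((hYS.trans hS).trans sdiff_subset)
  -- rank of the complement of the flat
  have hcomp : M.eRk (M.E \ M.closure (insert a X)) + 1 ≤ M.eRk (insert a Y) := by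
    have hna : a ∉ M.closure (M.E \ M.closure (insert a X)) := by
      rw [rep_mem_closure hG.rep sdiff_subset ha]
      intro hmem
      have hle : Submodule.span (ZMod 2) (φ '' (M.E \ M.closure (insert a X))) ≤
          LinearMap.ker ψ := by
        rw [Submodule.span_le]
        rintro _ ⟨t, ht, rfl⟩
        exact h0 t ⟨ht.1, fun h => ht.2 (hKX h)⟩
      have := hle hmem
      rw [LinearMap.mem_ker, h1 a haK] at this
      exact absurd this (by decide)
    rw [← eRk_insert_eq_add_one ⟨ha, hna⟩, ← M.eRk_closure_eq (insert a Y)]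
    apply M.eRk_mono
    rw [insert_subset_iff]
    refine ⟨M.mem_closure_of_mem (by simp) hYE, fun t ht => ?_⟩
    exact (hXY t ht.1).resolve_left ht.2
  have f1 := ne_top_of_le_ne_top hr (M.eRk_le_eRank (insert a X))
  have f2 := ne_top_of_le_ne_top hr (M.eRk_le_eRank (insert a Y))
  have f3 := ne_top_of_le_ne_top hr (M.eRk_le_eRank (M.E \ M.closure (insert a X)))
  have hle : ∀ {n m : ℕ∞}, n + 1 = m → m ≠ ⊤ → n ≠ ⊤ := by
    rintro n m rfl h rfl; exact h (by simp)
  have g1 := hle cX f1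
  have g2 := hle cY f2
  have g3 := hle cS hr
  have hfull : M.E \ M.closure (insert a X) = ∅ := by
    by_contra hne
    have h4 := hG.four_le h3 (nonempty_iff_ne_empty.2 hne)
    have h6 : 6 ≤ (M.closure (insert a X)).encard := hK6 ▸ encard_le_encard hKX
    have hsep3 : IsKSeparation M 3 (M.closure (insert a X)) (M.E \ M.closure (insert a X)) := by
      refine ⟨disjoint_sdiff_right, union_sdiff_cancel (M.closure_subset_ground _), ?_, ?_, ?_⟩
      · rw [eRk_eq, eRank_eq, eRank_eq, M.eRk_closure_eq]
        generalize M.eRk (insert a X) = p at *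
        generalize M.eRk (insert a Y) = q at *
        generalize M.eRk (M.E \ M.closure (insert a X)) = t at *
        generalize M.eRank = r at *
        generalize (M ／ {a}).eRk X = p' at *
        generalize (M ／ {a}).eRk Y = q' at *
        generalize (M ／ {a}).eRk S = r' at *
        lift p to ℕ using f1
        lift q to ℕ using f2
        lift t to ℕ using f3
        lift r to ℕ using hr
        lift p' to ℕ using g1
        lift q' to ℕ using g2
        lift r' to ℕ using g3
        norm_cast at *
        omega
      · exact le_trans (by norm_num) h6
      · exact le_trans (by norm_num) h4
    have n6 : (M.closure (insert a X)).encard ≠ 3 := by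
      intro h; rw [h] at h6; norm_num at h6
    have n4 : (M.E \ M.closure (insert a X)).encard ≠ 3 := by
      intro h; rw [h] at h4; norm_num at h4
    rcases hI4.2 _ _ hsep3 with h | h | h | h
    · exact n6 h.2
    · exact n6 h.2
    · exact n4 h.2
    · exact n4 h.2
  have hEX : M.eRk (insert a X) = M.eRank := by
    rw [← M.eRk_closure_eq]
    exact eRk_eq_eRank (sdiff_eq_empty.1 hfull)
  refine hG.small ha hS hYS hp hs hk1 hk3 hkY ?_
  rw [hEX] at cX
  have hpr : (M ／ {a}).eRk X = (M ／ {a}).eRk S :=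
    ENat.add_left_injective_of_ne_top ENat.one_ne_top (cX.trans cS.symm)
  rw [hpr] at hrk
  exact (WithTop.add_le_add_iff_left g3).1 hrk

lemma Good.core (hG : Good M φ) (hI4 : InternallyFourConnected M)
    (h3 : EveryElementInThreeTriangles M) (hr : M.eRank ≠ ⊤) {K : Set α} (hKE : K ⊆ M.E)
    {ψ : V →ₗ[ZMod 2] ZMod 2} (h1 : ∀ x ∈ K, ψ (φ x) = 1)
    (h0 : ∀ x ∈ M.E \ K, ψ (φ x) = 0) (hK6 : K.encard = 6) {a b c d e f : α}
    (hK : K = {a, b, c, d, e, f}) (r1 : φ a + φ b = φ c + φ d) (r2 : φ a + φ b = φ e + φ f) :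
    SiContractI4C M a := by
  rintro N ⟨S, hS, rfl, hnl, hun⟩
  change ∀ f, Nonloop (M ／ {a}) f → _ at hun
  change S ⊆ M.E \ {a} at hS
  change ∀ e ∈ S, (M ／ {a}).Indep {e} at hnl
  change InternallyFourConnected ((M ／ {a}) ↾ S)
  have haK : a ∈ K := by rw [hK]; simp
  have ha : a ∈ M.E := hKE haK
  have hp : ∀ x ∈ S, ∀ y ∈ S, x ≠ y → (M ／ {a}).Indep {x, y} := by
    intro x hx y hy hxy
    by_contra hc
    have hcl := ((indep_singleton.1 (hnl x hx)).closure_eq_closure_iff_eq_or_dep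
      (indep_singleton.1 (hnl y hy))).2 (Or.inr hc)
    exact hxy ((hun y (hnl y hy)).unique ⟨hx, hcl⟩ ⟨hy, rfl⟩)
  have hcover : ∀ x ∈ M.E, x ∈ M.closure {a} ∨ ∃ s ∈ S, x ∈ M.closure {a, s} := by
    intro x hx
    by_cases hxa : x ∈ M.closure {a}
    · exact Or.inl hxa
    right
    have hn : (M ／ {a}).IsNonloop x := contract_isNonloop_iff.2 ⟨hx, hxa⟩
    obtain ⟨s, ⟨hs, hcl⟩, -⟩ := hun x (indep_singleton.2 hn)
    refine ⟨s, hs, ?_⟩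
    have : x ∈ (M ／ {a}).closure {s} := by
      change (M ／ {a}).closure {s} = (M ／ {a}).closure {x} at hcl
      rw [hcl]
      exact mem_closure_self _ _ hn.mem_ground
    rw [contract_closure_eq] at this
    rw [pair_comm]
    exact this.1
  have hSE : insert a S ⊆ M.E := insert_subset ha (hS.trans sdiff_subset)
  have hsp : M.eRk (insert a S) = M.eRank := by
    rw [← M.eRk_closure_eq]
    refine eRk_eq_eRank fun x hx => ?_
    rcases hcover x hx with h | ⟨s, hs, h⟩
    · exact M.closure_subset_closure (by simp) h
    · exact M.closure_subset_closure (pair_subset (by simp) (by simp [hs])) h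
  obtain ⟨w, hw, hcw⟩ := hG.exists_w h3 hKE h1 h0 hK hK6 r1 r2
  have main : ∀ k, 1 ≤ k → k < 4 → ∀ X Y, IsKSeparation ((M ／ {a}) ↾ S) k X Y →
      k = 3 ∧ (IsTriangle ((M ／ {a}) ↾ S) X ∨ IsTriangle ((M ／ {a}) ↾ S) Y) := by
    intro k hk1 hk3 X Y hsep
    have hXYS : X ∪ Y = S := hsep.2.1
    have hXY : ∀ x ∈ M.E, x ∈ M.closure (insert a X) ∨ x ∈ M.closure (insert a Y) := by
      intro x hx
      rcases hcover x hx with h | ⟨s, hs, h⟩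
      · exact Or.inl (M.closure_subset_closure (by simp) h)
      · rw [← hXYS] at hs
        rcases hs with hs | hs
        · exact Or.inl (M.closure_subset_closure (pair_subset (by simp) (by simp [hs])) h)
        · exact Or.inr (M.closure_subset_closure (pair_subset (by simp) (by simp [hs])) h)
    have hsep' : IsKSeparation ((M ／ {a}) ↾ S) k Y X := by
      obtain ⟨q1, q2, q3, q4, q5⟩ := hsep
      exact ⟨q1.symm, by rw [union_comm, q2], by rw [add_comm]; exact q3, q5, q4⟩
    have haX : a ∈ M.closure (insert a X) := M.mem_closure_of_mem' (by simp) ha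
    have haY : a ∈ M.closure (insert a Y) := M.mem_closure_of_mem' (by simp) ha
    have mem : ∀ x ∈ ({a, b, c, d, e, f} : Set α), x ∈ M.E := fun x hx => hKE (hK ▸ hx)
    have side : K ⊆ M.closure (insert a X) ∨ K ⊆ M.closure (insert a Y) := by
      rcases hcw with hcw | hcw
      · rw [hK]
        exact hG.span_side (mem b (by simp)) (mem c (by simp)) (mem d (by simp)) (mem e (by simp))
          (mem f (by simp)) hw r1 r2 hcw haX haY hXY
      · have : K = {a, b, c, d, f, e} := by rw [hK, pair_comm e f]
        rw [this]
        exact hG.span_side (mem b (by simp)) (mem c (by simp)) (mem d (by simp)) (mem f (by simp))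
          (mem e (by simp)) hw r1 (r2.trans (add_comm _ _)) hcw haX haY hXY
    rcases side with h | h
    · obtain ⟨q1, q2⟩ := hG.half hI4 h3 hr h1 h0 hK6 haK ha hS hp hnl hk1 hk3 hsp hsep hXY h
      exact ⟨q1, Or.inr q2⟩
    · obtain ⟨q1, q2⟩ := hG.half hI4 h3 hr h1 h0 hK6 haK ha hS hp hnl hk1 hk3 hsp hsep'
        (fun x hx => (hXY x hx).symm) h
      exact ⟨q1, Or.inl q2⟩
  refine ⟨fun k hk1 hk3 X Y hsep => ?_, fun X Y hsep => ?_⟩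
  · have := (main k hk1 (by omega) X Y hsep).1
    omega
  · rcases (main 3 (by norm_num) (by norm_num) X Y hsep).2 with h | h
    · exact Or.inl h
    · exact Or.inr (Or.inr (Or.inl h))

/-- The sum of a four-element circuit vanishes. -/
lemma Good.circuit4 (hG : Good M φ) {a b c d : α} (hC : M.IsCircuit {a, b, c, d})
    (hab : a ≠ b) (hac : a ≠ c) (had : a ≠ d) (hbc : b ≠ c) (hbd : b ≠ d) (hcd : c ≠ d) :
    φ a + φ b = φ c + φ d := by
  have hsub := hC.subset_ground
  have hmem : a ∈ M.closure {b, c, d} := by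
    have := hC.mem_closure_sdiff_singleton_of_mem (e := a) (by simp)
    refine M.closure_subset_closure ?_ this
    rintro x ⟨rfl | h, hx⟩
    · exact absurd rfl hx
    · exact h
  have hns : ∀ T : Set α, T ⊆ {b, c, d} → T ≠ {b, c, d} → a ∉ M.closure T := by
    intro T hT hne hm
    have haT : a ∉ T := by
      intro h
      rcases hT h with h | h | h
      · exact hab h
      · exact hac h
      · exact had h
    have hi : M.Indep (insert a T) := by
      apply hC.ssubset_indep
      refine ⟨insert_subset_insert hT, fun h => hne (subset_antisymm hT ?_)⟩
      intro x hx
      rcases h (Or.inr hx) with rfl | h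
      · rcases hx with hx | hx | hx
        · exact absurd hx hab
        · exact absurd hx hac
        · exact absurd hx had
      · exact h
    have hTi : M.Indep T := hi.subset (subset_insert _ _)
    rw [hTi.insert_indep_iff_of_notMem haT] at hi
    exact hi.2 hm
  have ha : a ∈ M.E := hsub (by simp)
  have hbcd : {b, c, d} ⊆ M.E := (subset_insert _ _).trans hsub
  have hns' : ∀ T : Set α, T ⊆ {b, c, d} → T ≠ {b, c, d} →
      φ a ∉ Submodule.span (ZMod 2) (φ '' T) := fun T hT hne =>
    fun h => hns T hT hne ((rep_mem_closure hG.rep (hT.trans hbcd) ha).2 h)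
  rw [rep_mem_closure hG.rep hbcd ha, image_insert_eq, image_pair,
    Submodule.mem_span_insert] at hmem
  obtain ⟨p, v, hv, hav⟩ := hmem
  rw [Submodule.mem_span_pair] at hv
  obtain ⟨q, r, rfl⟩ := hv
  have n1 := hns' {c, d} (by intro x hx; exact Or.inr hx)
    (fun h => by
      have : b ∈ ({c, d} : Set α) := by rw [h]; simp
      simp [hbc, hbd] at this)
  have n2 := hns' {b, d} (by rintro x (rfl | rfl) <;> simp)
    (fun h => by
      have : c ∈ ({b, d} : Set α) := by rw [h]; simp
      simp [hbc.symm, hcd] at this)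
  have n3 := hns' {b, c} (by rintro x (rfl | rfl) <;> simp)
    (fun h => by
      have : d ∈ ({b, c} : Set α) := by rw [h]; simp
      simp [hbd.symm, hcd.symm] at this)
  rw [image_pair, Submodule.mem_span_pair] at n1 n2 n3
  rcases zmod2 p with rfl | rfl
  · exact absurd ⟨q, r, by rw [hav]; simp⟩ n1
  rcases zmod2 q with rfl | rfl
  · exact absurd ⟨1, r, by rw [hav]; simp⟩ n2
  rcases zmod2 r with rfl | rfl
  · exact absurd ⟨1, 1, by rw [hav]; simp⟩ n3
  simp only [one_smul] at hav
  rw [hav, add_right_comm, two_zero, zero_add]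

end Aux2

theorem stmt11 (M : Matroid α) (hI4 : InternallyFourConnected M) (hB : Binary M)
    (h3 : EveryElementInThreeTriangles M) (hE : (14 : ℕ∞) ≤ M.E.encard)
    (a b c d e f : α) (hdist : ({a, b, c, d, e, f} : Set α).encard = 6)
    (hcc : Cocircuit M {a, b, c, d, e, f})
    (hc1 : Circuit M {a, b, c, d}) (hc2 : Circuit M {a, b, e, f}) :
    ∀ x ∈ ({a, b, c, d, e, f} : Set α), SiContractI4C M x := by
  obtain ⟨φ, hφ⟩ := hB
  have hR : Rep M φ := hφ
  have hG : Good M φ := ⟨hR, fun x hx => rep_ne_zero hR h3 hx, rep_inj hR hI4 hE⟩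
  have hr := rank_ne_top hI4 hE
  have hK : M.IsCocircuit {a, b, c, d, e, f} := (circuit_iff _ _).1 hcc
  obtain ⟨ψ, p1, p0⟩ := exists_functional hR hK
  have hKE := hK.subset_ground
  have hd := distinct_of hdist
  simp only [mem_insert_iff, mem_singleton_iff, not_or] at hd
  obtain ⟨⟨hab, hac, had, hae, haf⟩, ⟨hbc, hbd, hbe, hbf⟩, ⟨hcd, hce, hcf⟩, ⟨hde, hdf⟩, hef⟩ := hd
  have r1 := hG.circuit4 ((circuit_iff _ _).1 hc1) hab hac had hbc hbd hcd
  have r2 := hG.circuit4 ((circuit_iff _ _).1 hc2) hab hae haf hbe hbf hef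
  have r3 := r1.symm.trans r2
  have core := fun {a' b' c' d' e' f' : α} => hG.core hI4 h3 hr hKE p1 p0 hdist (a := a')
    (b := b') (c := c') (d := d') (e := e') (f := f')
  rintro x (rfl | rfl | rfl | rfl | rfl | hx)
  · exact core rfl r1 r2
  · refine core (b' := a) (c' := c) (d' := d) (e' := e) (f' := f) ?_ ?_ ?_
    · ext y; simp only [mem_insert_iff, mem_singleton_iff]; clear * -; grind
    · rw [add_comm, r1]
    · rw [add_comm, r2]
  · refine core (b' := d) (c' := a) (d' := b) (e' := e) (f' := f) ?_ r1.symm r3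
    ext y; simp only [mem_insert_iff, mem_singleton_iff]; clear * -; grind
  · refine core (b' := c) (c' := a) (d' := b) (e' := e) (f' := f) ?_ ?_ ?_
    · ext y; simp only [mem_insert_iff, mem_singleton_iff]; clear * -; grind
    · rw [add_comm, r1]
    · rw [add_comm, r3]
  · refine core (b' := f) (c' := a) (d' := b) (e' := c) (f' := d) ?_ r2.symm r3.symm
    ext y; simp only [mem_insert_iff, mem_singleton_iff]; clear * -; grind
  · obtain rfl : x = f := hx
    refine core (b' := e) (c' := a) (d' := b) (e' := c) (f' := d) ?_ ?_ ?_
    · ext y; simp only [mem_insert_iff, mem_singleton_iff]; clear * -; grind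
    · rw [add_comm, r2]
    · rw [add_comm, r3]

end Paper
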